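/- Let a finite loopless multigraph be given by finite types E (edges) and V (vertices) together with maps s, t : E → V satisfying s(e) ≠ t(e) for every e, where a circulation is a function f : E → ℤ with Σ_{e : s(e) = v} f(e) = Σ_{e : t(e) = v} f(e) for every vertex v. If some circulation is not identically zero, then among all nonzero circulations of minimal support size #{e : f(e) ≠ 0} there is one taking values only in {-1, 0, 1}. -/

import Mathlib

open Finset
open scoped Classical

/-- A circulation on a finite multigraph given by edge-endpoint maps `s t : E → V`:
an integer-valued function on edges satisfying the conservation law at every vertex. -/
def IsCirculation {E V : Type*} [Fintype E] (s t : E → V) (f : E → ℤ) : Prop :=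
  ∀ v : V, (∑ e : E, if s e = v then f e else 0) = ∑ e : E, if t e = v then f e else 0

/-- A self-map of a nonempty finite set restricts to a permutation of some nonempty subset. -/
lemma Finset.exists_nonempty_subset_bijOn {α : Type*} {S : Finset α} (hS : S.Nonempty)
    {φ : α → α} (hφ : Set.MapsTo φ S S) :
    ∃ O ⊆ S, O.Nonempty ∧ Set.BijOn φ O O := by
  obtain ⟨O, ⟨hOS, hO, hmaps⟩, hmin⟩ := exists_minimal_of_wellFoundedLT
    (fun O : Finset α => O ⊆ S ∧ O.Nonempty ∧ Set.MapsTo φ O O) ⟨S, Subset.rfl, hS, hφ⟩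
  have himage : O.image φ ⊆ O := image_subset_iff.2 fun a ha => hmaps ha
  have hle : O ⊆ O.image φ := hmin
    ⟨himage.trans hOS, hO.image φ, fun a ha => mem_image_of_mem φ (himage ha)⟩ himage
  have heq : O.image φ = O := himage.antisymm hle
  refine ⟨O, hOS, hO, hmaps, card_image_iff.1 (by rw [heq]), fun a ha => ?_⟩
  simpa using hle ha

/-- The start of `e` once it is oriented along the flow `f`. -/
def flowTail {E V : Type*} (s t : E → V) (f : E → ℤ) (e : E) : V :=
  if 0 < f e then s e else t e

/-- The end of `e` once it is oriented along the flow `f`. -/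
def flowHead {E V : Type*} (s t : E → V) (f : E → ℤ) (e : E) : V :=
  if 0 < f e then t e else s e

/-- Conservation may be checked after reorienting each edge in the support of `f` along `f`. -/
lemma isCirculation_mul_sign_iff {E V : Type*} [Fintype E] (s t : E → V) (f c : E → ℤ) :
    IsCirculation s t (fun e => c e * (f e).sign) ↔
      ∀ v, (∑ e, if flowTail s t f e = v then c e * |(f e).sign| else 0) =
        ∑ e, if flowHead s t f e = v then c e * |(f e).sign| else 0 := by
  refine forall_congr' fun v => ?_
  rw [← sub_eq_zero, ← sum_sub_distrib, ← sub_eq_zero (b := ∑ e, ite (flowHead s t f e = v) _ _),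
    ← sum_sub_distrib]
  refine Eq.congr_left (sum_congr rfl fun e _ => ?_)
  rcases lt_trichotomy (f e) 0 with h | h | h
  · simp only [flowTail, flowHead, Int.sign_eq_neg_one_of_neg h, h.not_gt, if_false]
    split_ifs <;> simp
  · simp [h]
  · simp [flowTail, flowHead, Int.sign_eq_one_of_pos h, h]

/-- A circulation that flows into a vertex also flows out of it. -/
lemma IsCirculation.exists_flowTail_eq_flowHead {E V : Type*} [Fintype E] {s t : E → V}
    {f : E → ℤ} (hf : IsCirculation s t f) {e : E} (he : f e ≠ 0) :
    ∃ e', f e' ≠ 0 ∧ flowTail s t f e' = flowHead s t f e := by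
  by_contra! hno
  have hcons := (isCirculation_mul_sign_iff s t f fun e => |f e|).1
    (by simpa only [mul_comm |f _|, Int.sign_mul_abs] using hf) (flowHead s t f e)
  rw [sum_eq_zero fun e' _ => ?_, eq_comm, sum_eq_zero_iff_of_nonneg] at hcons
  · simpa [he] using hcons e (mem_univ e)
  · intro e' _
    split_ifs <;> positivity
  · by_cases h : f e' = 0
    · simp [h]
    · simp [hno e' h]

/-- The support of a nonzero circulation contains that of a nonzero `{-1, 0, 1}`-valued one. -/
lemma IsCirculation.exists_unit_circulation {E V : Type*} [Fintype E] {s t : E → V}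
    {f : E → ℤ} (hf : IsCirculation s t f) (hf0 : f ≠ 0) :
    ∃ g : E → ℤ, IsCirculation s t g ∧ g ≠ 0 ∧ (∀ e, g e ≠ 0 → f e ≠ 0) ∧
      ∀ e, g e = -1 ∨ g e = 0 ∨ g e = 1 := by
  choose! φ hφ0 hφ using fun e (he : f e ≠ 0) => hf.exists_flowTail_eq_flowHead he
  obtain ⟨e₀, he₀⟩ := Function.ne_iff.1 hf0
  obtain ⟨O, hOS, ⟨e₁, he₁⟩, hbij⟩ := exists_nonempty_subset_bijOn
    (S := univ.filter fun e => f e ≠ 0) (φ := φ) ⟨e₀, by simpa using he₀⟩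
    (fun e he => by simpa using hφ0 e (by simpa using he))
  have hO : ∀ e ∈ O, f e ≠ 0 := fun e he => by simpa using hOS he
  refine ⟨fun e => (if e ∈ O then 1 else 0) * (f e).sign,
    (isCirculation_mul_sign_iff s t f _).2 fun v => ?_,
    Function.ne_iff.2 ⟨e₁, by simp [he₁, hO e₁ he₁]⟩, fun e he h => he (by simp [h]),
    fun e => ?_⟩
  · have hrestrict : ∀ w : E → V,
        (∑ e, if w e = v then (if e ∈ O then 1 else 0) * |(f e).sign| else 0) =
          ∑ e ∈ O, if w e = v then 1 else 0 := by
      intro w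
      rw [← sum_subset (subset_univ O) fun e _ he => by simp [he]]
      refine sum_congr rfl fun e he => ?_
      simp [he, Int.abs_sign_of_ne_zero (hO e he)]
    rw [hrestrict, hrestrict]
    refine (sum_nbij φ hbij.mapsTo hbij.injOn hbij.surjOn fun e he => ?_).symm
    rw [hφ e (hO e he)]
  · rcases Int.sign_trichotomy (f e) with h | h | h <;> by_cases he : e ∈ O <;> simp [h, he]

/-- In a finite loopless multigraph admitting a nonzero circulation, among
all nonzero circulations of minimal support size there is one taking values only in
`{-1, 0, 1}`. -/
theorem exists_min_support_unit_circulation {E V : Type*} [Fintype E] [Fintype V]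
    (s t : E → V) (hst : ∀ e, s e ≠ t e)
    (hex : ∃ f : E → ℤ, IsCirculation s t f ∧ f ≠ 0) :
    ∃ f : E → ℤ, IsCirculation s t f ∧ f ≠ 0 ∧
      (univ.filter fun e => f e ≠ 0).card =
        sInf {n : ℕ | ∃ g : E → ℤ, IsCirculation s t g ∧ g ≠ 0 ∧
          (univ.filter fun e => g e ≠ 0).card = n} ∧
      ∀ e, f e = -1 ∨ f e = 0 ∨ f e = 1 := by
  obtain ⟨f₀, hf₀, hf₀0⟩ := hex
  obtain ⟨f, hf, hf0, hcard⟩ := Nat.sInf_mem (s := {n : ℕ | ∃ g : E → ℤ, IsCirculation s t g ∧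
    g ≠ 0 ∧ (univ.filter fun e => g e ≠ 0).card = n}) ⟨_, f₀, hf₀, hf₀0, rfl⟩
  obtain ⟨g, hg, hg0, hsupp, hunit⟩ := hf.exists_unit_circulation hf0
  refine ⟨g, hg, hg0, le_antisymm ?_ (Nat.sInf_le ⟨g, hg, hg0, rfl⟩), hunit⟩
  rw [← hcard]
  exact card_le_card (monotone_filter_right _ fun e _ => hsupp e)
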